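/- Let γ be a nonzero Hermitian operator and σ a positive semidefinite operator on a finite-dimensional Hilbert space with supp(γ) ⊆ supp(σ). Then lim_{α→1⁺} ( D̃_α(γ∥σ) − (α/(α−1)) ln ‖γ‖_1 ) = D( |γ|/‖γ‖_1 ∥ σ ), where D is the Umegaki relative entropy and |γ| = (γ†γ)^(1/2). -/

import Mathlib

open scoped Kronecker
open Matrix Filter Topology
open scoped ComplexOrder
attribute [local instance] Classical.propDecidable

namespace QHE

/-- Functional calculus for Hermitian matrices (junk value `0` on non-Hermitian input). -/
noncomputable def mfun {n : Type*} [Fintype n] [DecidableEq n] (f : ℝ → ℝ)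
    (A : Matrix n n ℂ) : Matrix n n ℂ :=
  if hA : A.IsHermitian then
    (hA.eigenvectorUnitary : Matrix n n ℂ) *
      Matrix.diagonal (fun i => (f (hA.eigenvalues i) : ℂ)) *
      (star (hA.eigenvectorUnitary : Matrix n n ℂ))
  else 0

/-- Real power of a Hermitian matrix, taken on its support (`0 ^ r = 0`). -/
noncomputable def mpow {n : Type*} [Fintype n] [DecidableEq n] (A : Matrix n n ℂ) (r : ℝ) :
    Matrix n n ℂ :=
  mfun (fun x => if x = 0 then 0 else Real.rpow x r) A

/-- Logarithm of a Hermitian matrix, taken on its support. -/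
noncomputable def mlog {n : Type*} [Fintype n] [DecidableEq n] (A : Matrix n n ℂ) :
    Matrix n n ℂ :=
  mfun (fun x => if x = 0 then 0 else Real.log x) A

/-- `‖X‖_α ^ α = Tr[(Xᴴ X)^(α/2)]`, the α-th power of the Schatten α-norm. -/
noncomputable def schattenPow {n : Type*} [Fintype n] [DecidableEq n] (α : ℝ)
    (X : Matrix n n ℂ) : ℝ :=
  ((mpow (Xᴴ * X) (α / 2)).trace).re

/-- Support inclusion `supp γ ⊆ supp σ`, phrased as kernel inclusion `ker σ ⊆ ker γ`. -/
noncomputable def suppLE {n : Type*} [Fintype n] (γ σ : Matrix n n ℂ) : Prop :=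
  ∀ v : n → ℂ, σ.mulVec v = 0 → γ.mulVec v = 0

/-- Extended sandwiched Rényi quasi-divergence
`Q̃_α(γ∥σ) = ‖σ^((1-α)/(2α)) γ σ^((1-α)/(2α))‖_α^α`. -/
noncomputable def sandQ {n : Type*} [Fintype n] [DecidableEq n] (α : ℝ)
    (γ σ : Matrix n n ℂ) : ℝ :=
  schattenPow α (mpow σ ((1 - α) / (2 * α)) * γ * mpow σ ((1 - α) / (2 * α)))

/-- Extended sandwiched Rényi divergence (real-valued formula, meaningful when
`supp γ ⊆ supp σ`). -/
noncomputable def sandDR {n : Type*} [Fintype n] [DecidableEq n] (α : ℝ)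
    (γ σ : Matrix n n ℂ) : ℝ :=
  (1 / (α - 1)) * Real.log (sandQ α γ σ)

/-- Extended sandwiched Rényi divergence, `+∞` when the support condition fails. -/
noncomputable def sandD {n : Type*} [Fintype n] [DecidableEq n] (α : ℝ)
    (γ σ : Matrix n n ℂ) : EReal :=
  if suppLE γ σ then ((sandDR α γ σ : ℝ) : EReal) else ⊤

/-- Trace norm `‖X‖₁`. -/
noncomputable def traceNorm {n : Type*} [Fintype n] [DecidableEq n] (X : Matrix n n ℂ) : ℝ :=
  schattenPow 1 X

/-- Absolute value `|X| = (Xᴴ X)^(1/2)`. -/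
noncomputable def matAbs {n : Type*} [Fintype n] [DecidableEq n] (X : Matrix n n ℂ) :
    Matrix n n ℂ :=
  mpow (Xᴴ * X) (1 / 2 : ℝ)

/-- Umegaki relative entropy `Tr[ρ(ln ρ − ln σ)]` (real-valued formula). -/
noncomputable def umegakiR {n : Type*} [Fintype n] [DecidableEq n] (ρ σ : Matrix n n ℂ) : ℝ :=
  ((ρ * (mlog ρ - mlog σ)).trace).re

/-- Umegaki relative entropy, `+∞` when the support condition fails. -/
noncomputable def umegaki {n : Type*} [Fintype n] [DecidableEq n] (ρ σ : Matrix n n ℂ) : EReal :=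
  if suppLE ρ σ then ((umegakiR ρ σ : ℝ) : EReal) else ⊤

/-- Density operator: positive semidefinite with unit trace. -/
noncomputable def IsState {n : Type*} [Fintype n] (ρ : Matrix n n ℂ) : Prop :=
  ρ.PosSemidef ∧ ρ.trace = 1

/-- Unit-trace Hermitian operator. -/
def UnitTraceHerm {n : Type*} [Fintype n] (τ : Matrix n n ℂ) : Prop :=
  τ.IsHermitian ∧ τ.trace = 1

/-- `−ln x`, valued `+∞` for `x ≤ 0`. -/
noncomputable def negLogE (x : ℝ) : EReal :=
  if x ≤ 0 then ⊤ else ((-Real.log x : ℝ) : EReal)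

/-- Extended hypothesis-testing divergence
`D_H^ε(τ∥σ) = sup{−ln Tr[Λσ] : 0 ≤ Λ ≤ I, Tr[Λτ] ≥ 1−ε}`. -/
noncomputable def DH {n : Type*} [Fintype n] [DecidableEq n] (ε : ℝ)
    (τ σ : Matrix n n ℂ) : EReal :=
  ⨆ Λ ∈ {Λ : Matrix n n ℂ |
      Λ.PosSemidef ∧ (1 - Λ).PosSemidef ∧ 1 - ε ≤ ((Λ * τ).trace).re},
    negLogE (((Λ * σ).trace).re)

/-- Optimal error probability of state exclusion for the ensemble `(p, ρ)`. -/
noncomputable def Perr {n ι : Type*} [Fintype n] [DecidableEq n] [Fintype ι]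
    (p : ι → ℝ) (ρ : ι → Matrix n n ℂ) : ℝ :=
  sInf {e : ℝ | ∃ Λ : ι → Matrix n n ℂ, (∀ x, (Λ x).PosSemidef) ∧ (∑ x, Λ x = 1) ∧
    e = ∑ x, p x * (((Λ x) * (ρ x)).trace).re}

/-- Optimal success probability of state discrimination for the ensemble `(p, ρ)`. -/
noncomputable def Psucc {n ι : Type*} [Fintype n] [DecidableEq n] [Fintype ι]
    (p : ι → ℝ) (ρ : ι → Matrix n n ℂ) : ℝ :=
  sSup {e : ℝ | ∃ Λ : ι → Matrix n n ℂ, (∀ x, (Λ x).PosSemidef) ∧ (∑ x, Λ x = 1) ∧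
    e = ∑ x, p x * (((Λ x) * (ρ x)).trace).re}

/-- The probability simplex over a finite index type. -/
def probSimplex (ι : Type*) [Fintype ι] : Set (ι → ℝ) :=
  {s | (∀ x, 0 ≤ s x) ∧ ∑ x, s x = 1}

/-- CPTP maps, characterized by Kraus representations. -/
def IsCPTP {n m : Type*} [Fintype n] [DecidableEq n] [Fintype m] [DecidableEq m]
    (Φ : Matrix n n ℂ → Matrix m m ℂ) : Prop :=
  ∃ (k : ℕ) (K : Fin k → Matrix m n ℂ), (∑ i, (K i)ᴴ * K i = 1) ∧
    ∀ A, Φ A = ∑ i, K i * A * (K i)ᴴ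

/-- Completely positive maps, characterized by Kraus representations. -/
def IsCPMap {n m : Type*} [Fintype n] [DecidableEq n] [Fintype m] [DecidableEq m]
    (Φ : Matrix n n ℂ → Matrix m m ℂ) : Prop :=
  ∃ (k : ℕ) (K : Fin k → Matrix m n ℂ), ∀ A, Φ A = ∑ i, K i * A * (K i)ᴴ

/-- Extension `id_{C^d} ⊗ Φ` of a (linear) map `Φ` to a `d`-dimensional reference system. -/
noncomputable def matExt {n m : Type*} (Φ : Matrix n n ℂ → Matrix m m ℂ) (d : ℕ)
    (X : Matrix (Fin d × n) (Fin d × n) ℂ) : Matrix (Fin d × m) (Fin d × m) ℂ :=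
  Matrix.of fun p q => Φ (Matrix.of fun a b => X (p.1, a) (q.1, b)) p.2 q.2

/-- Partial trace over the first tensor factor. -/
noncomputable def ptraceFst {a b : Type*} [Fintype a] (X : Matrix (a × b) (a × b) ℂ) : Matrix b b ℂ :=
  Matrix.of fun i j => ∑ k : a, X (k, i) (k, j)

/-- `k`-fold tensor power `A^{⊗k}` of a matrix. -/
noncomputable def tensPow {n : Type*} [Fintype n] (A : Matrix n n ℂ) (k : ℕ) :
    Matrix (Fin k → n) (Fin k → n) ℂ :=
  Matrix.of fun f g => ∏ i, A (f i) (g i)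

/-- Max-divergence `D_max(ρ∥σ) = inf{ln λ : λ ≥ 0, ρ ≤ λσ}` (`+∞` if infeasible). -/
noncomputable def Dmax {n : Type*} [Fintype n] [DecidableEq n] (ρ σ : Matrix n n ℂ) : EReal :=
  ⨅ l ∈ {l : ℝ | 0 ≤ l ∧ (l • σ - ρ).PosSemidef}, ((Real.log l : ℝ) : EReal)

/-- Channel divergence induced by a family of state divergences `D`:
supremum over reference dimensions and bipartite input states. -/
noncomputable def Dch
    (D : (k : Type) → [Fintype k] → [DecidableEq k] → Matrix k k ℂ → Matrix k k ℂ → EReal)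
    {n m : Type} [Fintype n] [DecidableEq n] [Fintype m] [DecidableEq m]
    (N M : Matrix n n ℂ → Matrix m m ℂ) : EReal :=
  ⨆ (d : ℕ), ⨆ ρ ∈ {ρ : Matrix (Fin d × n) (Fin d × n) ℂ | IsState ρ},
    D (Fin d × m) (matExt N d ρ) (matExt M d ρ)


section Auxiliary

open scoped Matrix.Norms.L2Operator

variable {n : Type*} [Fintype n] [DecidableEq n]

section ScalarEstimate

theorem abs_le_exp_of_abs_log_le {b L : ℝ} (hb : |Real.log b| ≤ L) : |b| ≤ Real.exp L := by
  rcases eq_or_ne b 0 with rfl | h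
  · simpa using (Real.exp_pos L).le
  · rw [← Real.exp_log (abs_pos.2 h), Real.log_abs]
    exact Real.exp_le_exp.2 (abs_le.1 hb).2

theorem one_le_exp_mul_abs_of_abs_log_le {b L : ℝ} (h : b ≠ 0) (hb : |Real.log b| ≤ L) :
    1 ≤ Real.exp L * |b| := by
  rw [← Real.exp_log (abs_pos.2 h), Real.log_abs, ← Real.exp_add]
  exact Real.one_le_exp (by linarith [(abs_le.1 hb).1])

/-- `|x| ^ r`, with the convention that it vanishes at `x = 0` for every `r`. -/
noncomputable def absPow (r x : ℝ) : ℝ := if x = 0 then 0 else |x| ^ r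

theorem absPow_sub_taylor_le {b L r : ℝ} (hb : |Real.log b| ≤ L) (hr : |r - 1| * L ≤ 1) :
    |absPow r b - |b| - (r - 1) * (|b| * Real.log b)| ≤ Real.exp L * L ^ 2 * (r - 1) ^ 2 := by
  have hL : 0 ≤ L := (abs_nonneg _).trans hb
  rcases eq_or_ne b 0 with rfl | h
  · simp only [absPow, if_true, abs_zero, zero_mul, mul_zero, sub_zero]; positivity
  have hu : |(r - 1) * Real.log b| ≤ |r - 1| * L := by
    rw [abs_mul]; gcongr
  have key : absPow r b - |b| - (r - 1) * (|b| * Real.log b) =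
      |b| * (Real.exp ((r - 1) * Real.log b) - 1 - (r - 1) * Real.log b) := by
    have hp : |b| ^ r = |b| * Real.exp ((r - 1) * Real.log b) := by
      conv_rhs => rw [← Real.exp_log (abs_pos.2 h), Real.log_abs, ← Real.exp_add]
      rw [Real.rpow_def_of_pos (abs_pos.2 h), Real.log_abs]
      ring_nf
    rw [absPow, if_neg h, hp]; ring
  rw [key, abs_mul, abs_abs]
  calc |b| * |Real.exp ((r - 1) * Real.log b) - 1 - (r - 1) * Real.log b|
      ≤ Real.exp L * (|r - 1| * L) ^ 2 := by
        refine mul_le_mul (abs_le_exp_of_abs_log_le hb) ?_ (abs_nonneg _) (Real.exp_pos L).le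
        refine (Real.abs_exp_sub_one_sub_id_le (hu.trans hr)).trans ?_
        rw [← sq_abs]; gcongr
    _ = Real.exp L * L ^ 2 * (r - 1) ^ 2 := by rw [mul_pow, sq_abs]; ring

theorem abs_sub_abs_sub_mul_sign_le {a b L : ℝ} (hb : |Real.log b| ≤ L) :
    |(|b| - |a|) - (b - a) * SignType.sign a| ≤ 2 * Real.exp L * (b - a) ^ 2 := by
  have hE := Real.exp_pos L
  rcases eq_or_ne b 0 with rfl | hb0
  · have : (a * SignType.sign a : ℝ) = |a| := self_mul_sign a
    have h2 : (|(0:ℝ)| - |a|) - (0 - a) * SignType.sign a = 0 := by rw [abs_zero]; linarith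
    rw [h2, abs_zero]; positivity
  have h1 := one_le_exp_mul_abs_of_abs_log_le hb0 hb
  rcases lt_trichotomy a 0 with h | rfl | h
  · rcases lt_or_gt_of_ne hb0 with h' | h'
    · simp only [sign_neg h, SignType.coe_neg_one, abs_of_neg h, abs_of_neg h']
      rw [show -b - -a - (b - a) * -1 = 0 by ring, abs_zero]; positivity
    · rw [abs_of_pos h'] at h1
      simp only [sign_neg h, SignType.coe_neg_one, abs_of_neg h, abs_of_pos h']
      rw [show b - -a - (b - a) * -1 = 2 * b by ring, abs_of_pos (by linarith)]
      have : b * 1 ≤ (b - a) * (Real.exp L * (b - a)) := by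
        apply mul_le_mul _ _ zero_le_one _ <;> nlinarith
      nlinarith
  · simp only [sign_zero, SignType.coe_zero, abs_zero, sub_zero, mul_zero, abs_abs]
    have : |b| * 1 ≤ |b| * (Real.exp L * |b|) := by gcongr
    rw [← sq_abs]
    nlinarith [abs_nonneg b]
  · rcases lt_or_gt_of_ne hb0 with h' | h'
    · rw [abs_of_neg h'] at h1
      simp only [sign_pos h, SignType.coe_one, abs_of_pos h, abs_of_neg h']
      rw [show -b - a - (b - a) * 1 = 2 * -b by ring, abs_of_pos (by linarith)]
      have : (-b) * 1 ≤ (a - b) * (Real.exp L * (a - b)) := by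
        apply mul_le_mul _ _ zero_le_one _ <;> nlinarith
      nlinarith
    · simp only [sign_pos h, SignType.coe_one, abs_of_pos h, abs_of_pos h']
      rw [show b - a - (b - a) * 1 = 0 by ring, abs_zero]; positivity

theorem abs_mul_log_sub_le {a b L : ℝ} (ha : |Real.log a| ≤ L) (hb : |Real.log b| ≤ L) :
    |(|b| * Real.log b - |a| * Real.log a)| ≤ (L + Real.exp L ^ 2) * |b - a| := by
  have hE := Real.exp_pos L
  have hL : 0 ≤ L := (abs_nonneg _).trans hb
  rcases eq_or_ne a 0 with rfl | ha0
  · simp only [abs_zero, zero_mul, sub_zero, abs_mul, abs_abs]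
    nlinarith [abs_nonneg b, mul_nonneg (sq_nonneg (Real.exp L)) (abs_nonneg b)]
  rcases eq_or_ne b 0 with rfl | hb0
  · simp only [abs_zero, zero_mul, zero_sub, abs_neg, abs_mul, abs_abs]
    nlinarith [abs_nonneg a, mul_nonneg (sq_nonneg (Real.exp L)) (abs_nonneg a)]
  have hlog : ∀ x y : ℝ, x ≠ 0 → y ≠ 0 → |Real.log y| ≤ L →
      Real.log x - Real.log y ≤ Real.exp L * |x - y| := by
    intro x y hx hy hyL
    have hx' := abs_pos.2 hx
    have hy' := abs_pos.2 hy
    have h1 := one_le_exp_mul_abs_of_abs_log_le hy hyL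
    calc Real.log x - Real.log y = Real.log (|x| / |y|) := by
          rw [Real.log_div hx'.ne' hy'.ne', Real.log_abs, Real.log_abs]
      _ ≤ |x| / |y| - 1 := Real.log_le_sub_one_of_pos (by positivity)
      _ = (|x| - |y|) / |y| := by field_simp
      _ ≤ |x - y| / |y| := by gcongr; exact abs_sub_abs_le_abs_sub x y
      _ ≤ Real.exp L * |x - y| := by
          rw [div_le_iff₀ hy']; nlinarith [abs_nonneg (x - y)]
  have hl : |Real.log b - Real.log a| ≤ Real.exp L * |b - a| := by
    rw [abs_le]
    have h1 := hlog b a hb0 ha0 ha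
    have h2 := hlog a b ha0 hb0 hb
    rw [abs_sub_comm a b] at h2
    constructor <;> linarith
  rw [show |b| * Real.log b - |a| * Real.log a =
    Real.log b * (|b| - |a|) + |a| * (Real.log b - Real.log a) by ring]
  calc _ ≤ |Real.log b| * |(|b| - |a|)| + |a| * |Real.log b - Real.log a| := by
        refine (abs_add_le _ _).trans ?_
        rw [abs_mul, abs_mul, abs_abs]
    _ ≤ L * |b - a| + Real.exp L * (Real.exp L * |b - a|) := by
        refine add_le_add (mul_le_mul hb (abs_abs_sub_abs_le b a) (abs_nonneg _) hL)
          (mul_le_mul (abs_le_exp_of_abs_log_le ha) hl (abs_nonneg _) hE.le)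
    _ = _ := by ring

/-- First-order expansion of `|b| ^ r` around `b = a`, `r = 1`, uniform over those `a`, `b` which
either vanish or have absolute value in `[exp (-L), exp L]`. -/
theorem absPow_sub_expansion_le {a b L r : ℝ} (ha : |Real.log a| ≤ L) (hb : |Real.log b| ≤ L)
    (hr : |r - 1| * L ≤ 1) :
    |absPow r b - |a| - (b - a) * SignType.sign a - (r - 1) * (|a| * Real.log a)| ≤
      (Real.exp L * L ^ 2 + 2 * Real.exp L + (L + Real.exp L ^ 2)) *
        ((b - a) ^ 2 + (r - 1) ^ 2) := by
  have hE := Real.exp_pos L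
  have hL : 0 ≤ L := (abs_nonneg _).trans hb
  have h1 := absPow_sub_taylor_le hb hr
  have h2 := abs_sub_abs_sub_mul_sign_le (a := a) hb
  have h3 : |(r - 1) * (|b| * Real.log b - |a| * Real.log a)| ≤
      (L + Real.exp L ^ 2) * ((b - a) ^ 2 + (r - 1) ^ 2) := by
    rw [abs_mul]
    calc _ ≤ |r - 1| * ((L + Real.exp L ^ 2) * |b - a|) := by
          gcongr; exact abs_mul_log_sub_le ha hb
      _ = (L + Real.exp L ^ 2) * (|r - 1| * |b - a|) := by ring
      _ ≤ _ := by
          gcongr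
          rw [← sq_abs (b - a), ← sq_abs (r - 1)]
          nlinarith [sq_nonneg (|r - 1| - |b - a|), sq_nonneg (|r - 1|), sq_nonneg (|b - a|)]
  calc _ = |(absPow r b - |b| - (r - 1) * (|b| * Real.log b)) +
        ((|b| - |a|) - (b - a) * SignType.sign a) +
        (r - 1) * (|b| * Real.log b - |a| * Real.log a)| := by ring_nf
    _ ≤ _ := abs_add_three _ _ _
    _ ≤ Real.exp L * L ^ 2 * (r - 1) ^ 2 + 2 * Real.exp L * (b - a) ^ 2 +
        (L + Real.exp L ^ 2) * ((b - a) ^ 2 + (r - 1) ^ 2) := by gcongr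
    _ ≤ _ := by
      have : 0 ≤ Real.exp L * L ^ 2 * (b - a) ^ 2 := by positivity
      have : 0 ≤ 2 * Real.exp L * (r - 1) ^ 2 := by positivity
      nlinarith

end ScalarEstimate

section FunctionalCalculus

theorem mfun_eq_cfc (f : ℝ → ℝ) {A : Matrix n n ℂ} (hA : A.IsHermitian) : mfun f A = cfc f A := by
  rw [hA.cfc_eq, mfun, dif_pos hA, Matrix.IsHermitian.cfc, Unitary.conjStarAlgAut_apply]
  rfl

theorem continuousOn_spectrum (f : ℝ → ℝ) (A : Matrix n n ℂ) :
    ContinuousOn f (spectrum ℝ A) :=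
  (Matrix.finite_real_spectrum (A := A)).continuousOn f

theorem isHermitian_mfun (f : ℝ → ℝ) (A : Matrix n n ℂ) : (mfun f A).IsHermitian := by
  by_cases hA : A.IsHermitian
  · rw [mfun_eq_cfc f hA]
    exact cfc_predicate f A
  · rw [mfun, dif_neg hA]
    exact Matrix.isHermitian_zero

theorem mfun_comp (g f : ℝ → ℝ) {A : Matrix n n ℂ} (hA : A.IsHermitian) :
    mfun g (mfun f A) = mfun (fun x => g (f x)) A := by
  rw [mfun_eq_cfc g (isHermitian_mfun f A), mfun_eq_cfc f hA, mfun_eq_cfc _ hA]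
  exact (cfc_comp' g f A (((Matrix.finite_real_spectrum (A := A)).image f).continuousOn g)
    (continuousOn_spectrum f A) hA).symm

theorem mfun_mul (f g : ℝ → ℝ) {A : Matrix n n ℂ} (hA : A.IsHermitian) :
    mfun f A * mfun g A = mfun (fun x => f x * g x) A := by
  rw [mfun_eq_cfc f hA, mfun_eq_cfc g hA, mfun_eq_cfc _ hA]
  exact (cfc_mul f g A (continuousOn_spectrum f A) (continuousOn_spectrum g A)).symm

theorem mfun_const_mul (c : ℝ) (f : ℝ → ℝ) {A : Matrix n n ℂ} (hA : A.IsHermitian) :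
    c • mfun f A = mfun (fun x => c * f x) A := by
  rw [mfun_eq_cfc f hA, mfun_eq_cfc _ hA]
  exact (cfc_const_mul c f A (continuousOn_spectrum f A)).symm

theorem mfun_sub (f g : ℝ → ℝ) {A : Matrix n n ℂ} (hA : A.IsHermitian) :
    mfun f A - mfun g A = mfun (fun x => f x - g x) A := by
  rw [mfun_eq_cfc f hA, mfun_eq_cfc g hA, mfun_eq_cfc _ hA]
  exact (cfc_sub f g A (continuousOn_spectrum f A) (continuousOn_spectrum g A)).symm

theorem mfun_one {A : Matrix n n ℂ} (hA : A.IsHermitian) : mfun (fun _ => 1) A = 1 := by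
  rw [mfun_eq_cfc _ hA]
  exact cfc_const_one ℝ A hA

theorem mfun_id {A : Matrix n n ℂ} (hA : A.IsHermitian) : mfun (fun x => x) A = A := by
  rw [mfun_eq_cfc _ hA]
  exact cfc_id' ℝ A hA

theorem mfun_mul_self {A : Matrix n n ℂ} (hA : A.IsHermitian) :
    mfun (fun x => x * x) A = A * A := by
  rw [← mfun_mul _ _ hA, mfun_id hA]

/-- The transition probabilities between the eigenbases of two Hermitian matrices. -/
noncomputable def overlap {A B : Matrix n n ℂ} (hA : A.IsHermitian) (hB : B.IsHermitian)
    (i j : n) : ℝ :=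
  Complex.normSq ((star (hA.eigenvectorUnitary : Matrix n n ℂ) * hB.eigenvectorUnitary) i j)

theorem overlap_nonneg {A B : Matrix n n ℂ} (hA : A.IsHermitian) (hB : B.IsHermitian) (i j : n) :
    0 ≤ overlap hA hB i j := Complex.normSq_nonneg _

theorem trace_mfun_mul_mfun (f g : ℝ → ℝ) {A B : Matrix n n ℂ} (hA : A.IsHermitian)
    (hB : B.IsHermitian) :
    (mfun f A * mfun g B).trace.re =
      ∑ i, ∑ j, overlap hA hB i j * (f (hA.eigenvalues i) * g (hB.eigenvalues j)) := by
  rw [mfun, dif_pos hA, mfun, dif_pos hB]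
  set U : Matrix n n ℂ := (hA.eigenvectorUnitary : Matrix n n ℂ) with hU
  set V : Matrix n n ℂ := (hB.eigenvectorUnitary : Matrix n n ℂ) with hV
  set W := star U * V with hW
  have h : (U * diagonal (fun i => (f (hA.eigenvalues i) : ℂ)) * star U *
      (V * diagonal (fun i => (g (hB.eigenvalues i) : ℂ)) * star V)).trace =
      (diagonal (fun i => (f (hA.eigenvalues i) : ℂ)) * W *
        (diagonal (fun i => (g (hB.eigenvalues i) : ℂ)) * star W)).trace := by
    rw [hW, star_mul, star_star]
    simp only [mul_assoc]
    rw [Matrix.trace_mul_comm]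
    simp only [mul_assoc]
  rw [h, Matrix.trace, Complex.re_sum]
  refine Finset.sum_congr rfl fun i _ => ?_
  rw [Matrix.diag_apply, Matrix.mul_apply, Complex.re_sum]
  refine Finset.sum_congr rfl fun j _ => ?_
  rw [Matrix.diagonal_mul, Matrix.diagonal_mul, Matrix.star_apply, overlap]
  have : (f (hA.eigenvalues i) : ℂ) * W i j * ((g (hB.eigenvalues j) : ℂ) * star (W i j)) =
      ((Complex.normSq (W i j) * (f (hA.eigenvalues i) * g (hB.eigenvalues j)) : ℝ) : ℂ) := by
    push_cast
    rw [Complex.normSq_eq_conj_mul_self]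
    simp only [Complex.star_def]
    ring
  rw [this, Complex.ofReal_re]

theorem trace_mfun_left {A B : Matrix n n ℂ} (f : ℝ → ℝ) (hA : A.IsHermitian)
    (hB : B.IsHermitian) :
    (mfun f A).trace.re = ∑ i, ∑ j, overlap hA hB i j * f (hA.eigenvalues i) := by
  have := trace_mfun_mul_mfun f (fun _ => 1) hA hB
  simpa [mfun_one hB] using this

theorem trace_mfun_right {A B : Matrix n n ℂ} (f : ℝ → ℝ) (hA : A.IsHermitian)
    (hB : B.IsHermitian) :
    (mfun f B).trace.re = ∑ i, ∑ j, overlap hA hB i j * f (hB.eigenvalues j) := by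
  have := trace_mfun_mul_mfun (fun _ => 1) f hA hB
  simpa [mfun_one hA] using this

theorem trace_mfun (f : ℝ → ℝ) {A : Matrix n n ℂ} (hA : A.IsHermitian) :
    (mfun f A).trace.re = ∑ i, f (hA.eigenvalues i) := by
  rw [mfun, dif_pos hA, Matrix.trace_mul_comm, ← mul_assoc, Unitary.coe_star_mul_self, one_mul,
    Matrix.trace_diagonal, Complex.re_sum]
  simp

theorem sum_overlap {A B : Matrix n n ℂ} (hA : A.IsHermitian) (hB : B.IsHermitian) :
    ∑ i, ∑ j, overlap hA hB i j = Fintype.card n := by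
  have := trace_mfun_left (fun _ => 1) hA hB
  rw [mfun_one hA] at this
  simpa using this.symm

theorem trace_sub_mul_mfun (f : ℝ → ℝ) {A B : Matrix n n ℂ} (hA : A.IsHermitian)
    (hB : B.IsHermitian) :
    ((B - A) * mfun f A).trace.re = ∑ i, ∑ j, overlap hA hB i j *
      ((hB.eigenvalues j - hA.eigenvalues i) * f (hA.eigenvalues i)) := by
  have h1 := trace_mfun_mul_mfun f (fun x => x) hA hB
  have h2 := trace_mfun_left (fun x => x * f x) hA hB
  rw [mfun_id hB] at h1
  rw [← mfun_mul _ _ hA, mfun_id hA] at h2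
  rw [sub_mul, Matrix.trace_sub, Complex.sub_re, Matrix.trace_mul_comm, h1, h2,
    ← Finset.sum_sub_distrib]
  refine Finset.sum_congr rfl fun i _ => ?_
  rw [← Finset.sum_sub_distrib]
  exact Finset.sum_congr rfl fun j _ => by ring

theorem trace_sub_mul_sub {A B : Matrix n n ℂ} (hA : A.IsHermitian) (hB : B.IsHermitian) :
    ((B - A) * (B - A)).trace.re =
      ∑ i, ∑ j, overlap hA hB i j * (hB.eigenvalues j - hA.eigenvalues i) ^ 2 := by
  have h1 := trace_mfun_right (fun x => x * x) hA hB
  have h2 := trace_mfun_left (fun x => x * x) hA hB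
  have h3 := trace_mfun_mul_mfun (fun x => x) (fun x => x) hA hB
  rw [mfun_mul_self hB] at h1
  rw [mfun_mul_self hA] at h2
  rw [mfun_id hA, mfun_id hB] at h3
  have h4 : ((B - A) * (B - A)).trace.re =
      (B * B).trace.re + (A * A).trace.re - 2 * (A * B).trace.re := by
    rw [show (B - A) * (B - A) = B * B + A * A - A * B - B * A by noncomm_ring]
    simp only [Matrix.trace_sub, Matrix.trace_add, Complex.sub_re, Complex.add_re,
      Matrix.trace_mul_comm B A]
    ring
  rw [h4, h1, h2, h3]
  simp only [Finset.mul_sum, ← Finset.sum_add_distrib, ← Finset.sum_sub_distrib]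
  exact Finset.sum_congr rfl fun i _ => Finset.sum_congr rfl fun j _ => by ring

theorem mpow_mul_self {A : Matrix n n ℂ} (hA : A.IsHermitian) (r : ℝ) :
    mpow (Aᴴ * A) (r / 2) = mfun (absPow r) A := by
  rw [hA.eq, ← mfun_mul_self hA, mpow, mfun_comp _ _ hA]
  congr 1
  ext x
  rcases eq_or_ne x 0 with rfl | h
  · simp [absPow]
  · have h2 : (x * x) ^ (r / 2) = |x| ^ r := by
      rw [← abs_mul_abs_self, ← pow_two, ← Real.rpow_natCast,
        ← Real.rpow_mul (abs_nonneg x)]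
      congr 1
      push_cast
      ring
    simp [absPow, h, h2]

theorem schattenPow_eq {A : Matrix n n ℂ} (hA : A.IsHermitian) (r : ℝ) :
    schattenPow r A = (mfun (absPow r) A).trace.re := by
  rw [schattenPow, mpow_mul_self hA]

theorem absPow_one : absPow 1 = fun x => |x| := by
  ext x
  rcases eq_or_ne x 0 with rfl | h <;> simp_all [absPow]

theorem traceNorm_eq {A : Matrix n n ℂ} (hA : A.IsHermitian) :
    traceNorm A = (mfun (fun x => |x|) A).trace.re := by
  rw [traceNorm, schattenPow_eq hA, absPow_one]

theorem matAbs_eq {A : Matrix n n ℂ} (hA : A.IsHermitian) :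
    matAbs A = mfun (fun x => |x|) A := by
  rw [matAbs, mpow_mul_self hA, absPow_one]

theorem traceNorm_pos {A : Matrix n n ℂ} (hA : A.IsHermitian) (h0 : A ≠ 0) : 0 < traceNorm A := by
  rw [traceNorm_eq hA, trace_mfun _ hA]
  have h : hA.eigenvalues ≠ 0 := fun h => h0 (hA.eigenvalues_eq_zero_iff.1 h)
  obtain ⟨i, hi⟩ := Function.ne_iff.1 h
  exact Finset.sum_pos' (fun i _ => abs_nonneg _) ⟨i, Finset.mem_univ i, abs_pos.2 hi⟩

theorem schattenPow_sub_expansion_le {A B : Matrix n n ℂ} (hA : A.IsHermitian)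
    (hB : B.IsHermitian) {L r : ℝ} (ha : ∀ i, |Real.log (hA.eigenvalues i)| ≤ L)
    (hb : ∀ i, |Real.log (hB.eigenvalues i)| ≤ L) (hr : |r - 1| * L ≤ 1) :
    |schattenPow r B - traceNorm A - ((B - A) * mfun (fun x => SignType.sign x) A).trace.re -
        (r - 1) * (mfun (fun x => |x| * Real.log x) A).trace.re| ≤
      (Real.exp L * L ^ 2 + 2 * Real.exp L + (L + Real.exp L ^ 2)) *
        (((B - A) * (B - A)).trace.re + Fintype.card n * (r - 1) ^ 2) := by
  rw [schattenPow_eq hB, traceNorm_eq hA, trace_mfun_right _ hA hB, trace_mfun_left _ hA hB,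
    trace_mfun_left _ hA hB, trace_sub_mul_mfun _ hA hB, trace_sub_mul_sub hA hB,
    ← sum_overlap hA hB]
  simp only [Finset.mul_sum, Finset.sum_mul, ← Finset.sum_add_distrib, ← Finset.sum_sub_distrib]
  refine (Finset.abs_sum_le_sum_abs _ _).trans (Finset.sum_le_sum fun i _ => ?_)
  refine (Finset.abs_sum_le_sum_abs _ _).trans (Finset.sum_le_sum fun j _ => ?_)
  have h := mul_le_mul_of_nonneg_left (absPow_sub_expansion_le (ha i) (hb j) hr)
    (overlap_nonneg hA hB i j)
  rw [← abs_of_nonneg (overlap_nonneg hA hB i j), ← abs_mul,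
    abs_of_nonneg (overlap_nonneg hA hB i j)] at h
  convert h using 1
  · congr 1; ring
  · ring

end FunctionalCalculus

section SpectralBounds

theorem norm_apply_le_l2_opNorm (A : Matrix n n ℂ) (i j : n) : ‖A i j‖ ≤ ‖A‖ := by
  have h := Matrix.l2_opNorm_mulVec A (EuclideanSpace.single j (1 : ℂ))
  rw [PiLp.norm_single, norm_one, mul_one] at h
  refine le_trans ?_ h
  have h2 := PiLp.norm_apply_le (p := 2)
    (WithLp.toLp 2 (A *ᵥ (WithLp.ofLp (EuclideanSpace.single j (1 : ℂ)))) : EuclideanSpace ℂ n) i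
  simpa using h2

theorem norm_star_unitary_mul_mul_apply_le (U : Matrix.unitaryGroup n ℂ) (A : Matrix n n ℂ)
    (i j : n) : ‖(star (U : Matrix n n ℂ) * A * U) i j‖ ≤ ‖A‖ := by
  refine (norm_apply_le_l2_opNorm _ i j).trans_eq ?_
  rw [CStarRing.norm_mul_coe_unitary, ← Unitary.coe_star, CStarRing.norm_coe_unitary_mul]

theorem star_eigenvectorUnitary_mul_mul {A : Matrix n n ℂ} (hA : A.IsHermitian) :
    star (hA.eigenvectorUnitary : Matrix n n ℂ) * A * hA.eigenvectorUnitary =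
      diagonal (fun i => (hA.eigenvalues i : ℂ)) := by
  have h := hA.conjStarAlgAut_star_eigenvectorUnitary
  rw [Unitary.conjStarAlgAut_star_apply] at h
  exact h

/-- If `A` is Hermitian with a generalized inverse `B`, then its nonzero eigenvalues are controlled
by the norms of `A` and `B`. -/
theorem abs_log_eigenvalues_le {A B : Matrix n n ℂ} (hA : A.IsHermitian) (h : A * B * A = A)
    {M : ℝ} (hM : 1 ≤ M) (hAM : ‖A‖ ≤ M) (hBM : ‖B‖ ≤ M) (i : n) :
    |Real.log (hA.eigenvalues i)| ≤ Real.log M := by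
  have hlM := Real.log_nonneg hM
  rcases eq_or_ne (hA.eigenvalues i) 0 with h0 | h0
  · simpa [h0] using hlM
  set U := hA.eigenvectorUnitary
  set D := diagonal (fun i => (hA.eigenvalues i : ℂ)) with hD
  set Z := star (U : Matrix n n ℂ) * B * U with hZ
  have hDA : star (U : Matrix n n ℂ) * A * U = D := star_eigenvectorUnitary_mul_mul hA
  have hDZ : D * Z * D = D := by
    rw [← hDA, hZ]
    calc _ = star (U : Matrix n n ℂ) * A * (U * star (U : Matrix n n ℂ)) * B *
          (U * star (U : Matrix n n ℂ)) * A * U := by simp only [mul_assoc]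
      _ = _ := by
          rw [Unitary.mul_star_self_of_mem U.2, mul_one, mul_one]
          conv_rhs => rw [← h]
          simp only [mul_assoc]
  have hii := congrFun (congrFun hDZ i) i
  rw [hD, Matrix.mul_diagonal, Matrix.diagonal_mul, Matrix.diagonal_apply_eq] at hii
  have h0' : (hA.eigenvalues i : ℂ) ≠ 0 := Complex.ofReal_ne_zero.2 h0
  have hZi : (hA.eigenvalues i : ℂ) * Z i i = 1 := mul_right_cancel₀ h0' (by rw [hii, one_mul])
  have hn := congrArg norm hZi
  rw [norm_mul, norm_one, Complex.norm_real, Real.norm_eq_abs] at hn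
  have hZM : ‖Z i i‖ ≤ M := (norm_star_unitary_mul_mul_apply_le U B i i).trans hBM
  have hM' : |hA.eigenvalues i| ≤ M := by
    have := (norm_star_unitary_mul_mul_apply_le U A i i).trans hAM
    rwa [hDA, hD, Matrix.diagonal_apply_eq, Complex.norm_real, Real.norm_eq_abs] at this
  have hpos := abs_pos.2 h0
  rw [← Real.log_abs, abs_le]
  constructor
  · rw [← Real.log_inv]
    refine Real.log_le_log (by positivity) ?_
    rw [inv_le_iff_one_le_mul₀ (by positivity)]
    nlinarith
  · exact Real.log_le_log hpos hM'

end SpectralBounds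

section Derivative

theorem exists_mfun_eq_sum {A : Matrix n n ℂ} (hA : A.IsHermitian) :
    ∃ E : n → Matrix n n ℂ, ∀ f : ℝ → ℝ, mfun f A = ∑ i, f (hA.eigenvalues i) • E i := by
  refine ⟨fun i => Matrix.of fun k l => (hA.eigenvectorUnitary : Matrix n n ℂ) k i *
    star ((hA.eigenvectorUnitary : Matrix n n ℂ) l i), fun f => ?_⟩
  ext k l
  rw [mfun, dif_pos hA, Matrix.mul_apply, Matrix.sum_apply]
  refine Finset.sum_congr rfl fun i _ => ?_
  rw [Matrix.mul_diagonal, Matrix.star_apply, Matrix.smul_apply, Complex.real_smul]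
  simp only [Matrix.of_apply]
  ring

theorem hasDerivAt_mpow_zero {σ : Matrix n n ℂ} (hσ : σ.PosSemidef) :
    HasDerivAt (fun s : ℝ => mpow σ s) (mlog σ) 0 := by
  obtain ⟨E, hE⟩ := exists_mfun_eq_sum hσ.isHermitian
  simp only [mpow, mlog, hE]
  refine HasDerivAt.fun_sum fun i _ => HasDerivAt.smul_const ?_ _
  rcases (hσ.eigenvalues_nonneg i).eq_or_lt with h | h
  · simpa [← h] using hasDerivAt_const (0 : ℝ) (0 : ℝ)
  · simpa [h.ne'] using (Real.hasStrictDerivAt_const_rpow h 0).hasDerivAt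

theorem mpow_mul_mpow {σ : Matrix n n ℂ} (hσ : σ.PosSemidef) (r s : ℝ) :
    mpow σ r * mpow σ s = mpow σ (r + s) := by
  obtain ⟨E, hE⟩ := exists_mfun_eq_sum hσ.isHermitian
  rw [mpow, mpow, mpow, mfun_mul _ _ hσ.isHermitian, hE, hE]
  refine Finset.sum_congr rfl fun i _ => ?_
  rcases (hσ.eigenvalues_nonneg i).eq_or_lt with h | h
  · simp [← h]
  · simp [h.ne', Real.rpow_add h]

theorem isHermitian_mpow (σ : Matrix n n ℂ) (r : ℝ) : (mpow σ r).IsHermitian :=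
  isHermitian_mfun _ _

theorem mul_mpow_zero {σ : Matrix n n ℂ} (hσ : σ.IsHermitian) : σ * mpow σ 0 = σ := by
  have h : mfun (fun x => x) σ * mpow σ 0 = mfun (fun x => x) σ := by
    rw [mpow, mfun_mul _ _ hσ]
    congr 1
    ext x
    by_cases h : x = 0 <;> simp [h]
  rwa [mfun_id hσ] at h

theorem mul_mpow_zero_of_suppLE {γ σ : Matrix n n ℂ} (hσ : σ.IsHermitian) (hs : suppLE γ σ) :
    γ * mpow σ 0 = γ := by
  have h : γ * (1 - mpow σ 0) = 0 := by
    have h0 : σ * (1 - mpow σ 0) = 0 := by rw [mul_sub, mul_one, mul_mpow_zero hσ, sub_self]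
    ext i j
    have h1 : σ *ᵥ (fun k => (1 - mpow σ 0) k j) = 0 := by
      ext k
      exact congrFun (congrFun h0 k) j
    exact congrFun (hs _ h1) i
  rw [mul_sub, mul_one, sub_eq_zero] at h
  exact h.symm

theorem mpow_zero_mul_of_suppLE {γ σ : Matrix n n ℂ} (hγ : γ.IsHermitian) (hσ : σ.IsHermitian)
    (hs : suppLE γ σ) : mpow σ 0 * γ = γ := by
  have h := congrArg Matrix.conjTranspose (mul_mpow_zero_of_suppLE hσ hs)
  rwa [Matrix.conjTranspose_mul, (isHermitian_mpow σ 0).eq, hγ.eq] at h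

/-- The matrix whose Schatten norm defines the sandwiched quantity. -/
noncomputable def sandwich (γ σ : Matrix n n ℂ) (s : ℝ) : Matrix n n ℂ :=
  mpow σ s * γ * mpow σ s

theorem isHermitian_sandwich {γ : Matrix n n ℂ} (hγ : γ.IsHermitian) (σ : Matrix n n ℂ) (s : ℝ) :
    (sandwich γ σ s).IsHermitian := by
  rw [Matrix.IsHermitian, sandwich, Matrix.conjTranspose_mul, Matrix.conjTranspose_mul,
    (isHermitian_mpow σ s).eq, hγ.eq, mul_assoc]

theorem sandwich_zero {γ σ : Matrix n n ℂ} (hγ : γ.IsHermitian) (hσ : σ.IsHermitian)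
    (hs : suppLE γ σ) : sandwich γ σ 0 = γ := by
  rw [sandwich, mpow_zero_mul_of_suppLE hγ hσ hs, mul_mpow_zero_of_suppLE hσ hs]

theorem mul_mfun_inv_mul {γ : Matrix n n ℂ} (hγ : γ.IsHermitian) :
    γ * mfun (fun x => x⁻¹) γ * γ = γ := by
  have h : mfun (fun x => x) γ * mfun (fun x => x⁻¹) γ * mfun (fun x => x) γ =
      mfun (fun x => x) γ := by
    rw [mfun_mul _ _ hγ, mfun_mul _ _ hγ]
    congr 1
    ext x
    exact mul_inv_mul_cancel x
  rwa [mfun_id hγ] at h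

theorem sandwich_mul_sandwich_mul_sandwich {γ σ : Matrix n n ℂ} (hγ : γ.IsHermitian)
    (hσ : σ.PosSemidef) (hs : suppLE γ σ) (s : ℝ) :
    sandwich γ σ s * sandwich (mfun (fun x => x⁻¹) γ) σ (-s) * sandwich γ σ s =
      sandwich γ σ s := by
  have h1 := mpow_mul_mpow hσ s (-s)
  have h2 := mpow_mul_mpow hσ (-s) s
  rw [add_neg_cancel] at h1
  rw [neg_add_cancel] at h2
  simp only [sandwich]
  set P := mpow σ s
  set N := mpow σ (-s)
  set G := mfun (fun x => x⁻¹) γ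
  calc _ = P * (γ * (P * N)) * G * ((N * P) * γ) * P := by simp only [mul_assoc]
    _ = P * (γ * G * γ) * P := by
      rw [h1, h2, mul_mpow_zero_of_suppLE hσ.isHermitian hs,
        mpow_zero_mul_of_suppLE hγ hσ.isHermitian hs]
      simp only [mul_assoc]
    _ = _ := by rw [mul_mfun_inv_mul hγ]

theorem hasDerivAt_sandwich_zero {γ σ : Matrix n n ℂ} (hγ : γ.IsHermitian) (hσ : σ.PosSemidef)
    (hs : suppLE γ σ) :
    HasDerivAt (sandwich γ σ) (mlog σ * γ + γ * mlog σ) 0 := by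
  have h := ((hasDerivAt_mpow_zero hσ).mul_const γ).mul (hasDerivAt_mpow_zero hσ)
  refine h.congr_deriv ?_
  rw [mpow_zero_mul_of_suppLE hγ hσ.isHermitian hs, mul_assoc,
    mul_mpow_zero_of_suppLE hσ.isHermitian hs]

theorem continuousAt_sandwich_zero (γ : Matrix n n ℂ) {σ : Matrix n n ℂ} (hσ : σ.PosSemidef) :
    ContinuousAt (sandwich γ σ) 0 :=
  (((hasDerivAt_mpow_zero hσ).mul_const γ).mul (hasDerivAt_mpow_zero hσ)).continuousAt

theorem hasDerivAt_trace_re {F : ℝ → Matrix n n ℂ} {F' : Matrix n n ℂ} {x : ℝ}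
    (hF : HasDerivAt F F' x) : HasDerivAt (fun t => (F t).trace.re) F'.trace.re x := by
  let τ : Matrix n n ℂ →ₗ[ℝ] ℝ := Complex.reLm ∘ₗ Matrix.traceLinearMap n ℝ ℂ
  exact (LinearMap.toContinuousLinearMap τ).hasFDerivAt.comp_hasDerivAt x hF

/-- The eigenvalues of `sandwich γ σ s` stay uniformly away from `0` and infinity, except for those
that vanish, as `s → 0`. -/
theorem exists_eventually_abs_log_eigenvalues_sandwich_le {γ σ : Matrix n n ℂ}
    (hγ : γ.IsHermitian) (hσ : σ.PosSemidef) (hs : suppLE γ σ) :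
    ∃ L : ℝ, 0 ≤ L ∧ ∀ᶠ s in 𝓝 (0 : ℝ),
      ∀ i, |Real.log ((isHermitian_sandwich hγ σ s).eigenvalues i)| ≤ L := by
  have hX := (continuousAt_sandwich_zero γ hσ).norm
  have hneg : Tendsto (fun s : ℝ => -s) (𝓝 0) (𝓝 0) := by
    simpa using (continuous_neg (G := ℝ)).tendsto 0
  have hY := (continuousAt_sandwich_zero (mfun (fun x => x⁻¹) γ) hσ).norm.tendsto.comp hneg
  set a := ‖sandwich γ σ 0‖
  set b := ‖sandwich (mfun (fun x => x⁻¹) γ) σ 0‖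
  have ha : 0 ≤ a := norm_nonneg _
  have hb : 0 ≤ b := norm_nonneg _
  refine ⟨Real.log (a + b + 1), Real.log_nonneg (by linarith), ?_⟩
  filter_upwards [hX.tendsto.eventually_le_const (show a < a + b + 1 by linarith),
    hY.eventually_le_const (show b < a + b + 1 by linarith)] with s h1 h2
  exact abs_log_eigenvalues_le _ (sandwich_mul_sandwich_mul_sandwich hγ hσ hs s) (by linarith) h1 h2

theorem trace_mul_add_mul_mul_mfun_sign {γ : Matrix n n ℂ} (hγ : γ.IsHermitian) (S : Matrix n n ℂ) :
    ((S * γ + γ * S) * mfun (fun x => SignType.sign x) γ).trace.re =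
      2 * (mfun (fun x => |x|) γ * S).trace.re := by
  have h1 : γ * mfun (fun x => SignType.sign x) γ = mfun (fun x => |x|) γ := by
    have h := mfun_mul (fun x => x) (fun x => SignType.sign x) hγ
    rw [mfun_id hγ] at h
    rw [h]
    congr 1
    ext x
    exact self_mul_sign x
  have h2 : mfun (fun x => SignType.sign x) γ * γ = mfun (fun x => |x|) γ := by
    have := congrArg Matrix.conjTranspose h1
    rwa [Matrix.conjTranspose_mul, (isHermitian_mfun _ _).eq, hγ.eq, (isHermitian_mfun _ _).eq]
      at this
  rw [add_mul, Matrix.trace_add, mul_assoc, h1, Matrix.trace_mul_comm (γ * S), ← mul_assoc, h2,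
    Matrix.trace_mul_comm S, Complex.add_re, two_mul]

theorem hasDerivAt_sandQ_one {γ σ : Matrix n n ℂ} (hγ : γ.IsHermitian) (hσ : σ.PosSemidef)
    (hs : suppLE γ σ) :
    HasDerivAt (fun r => sandQ r γ σ)
      ((mfun (fun x => |x| * Real.log x) γ).trace.re -
        (mfun (fun x => |x|) γ * mlog σ).trace.re) 1 := by
  have hX0 := sandwich_zero hγ hσ.isHermitian hs
  let e : ℝ → ℝ := fun r => (1 - r) / (2 * r)
  have he1 : e 1 = 0 := by simp [e]
  have he : HasDerivAt e (-1 / 2) 1 := by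
    have := ((hasDerivAt_id' (1 : ℝ)).const_sub 1).fun_div ((hasDerivAt_id' (1 : ℝ)).const_mul 2)
      (by norm_num)
    exact this.congr_deriv (by norm_num)
  have hQ : ∀ r, sandQ r γ σ = schattenPow r (sandwich γ σ (e r)) := fun r => rfl
  have hX : HasDerivAt (fun r => sandwich γ σ (e r) - γ)
      ((-1 / 2 : ℝ) • (mlog σ * γ + γ * mlog σ)) 1 :=
    by
    have h := hasDerivAt_sandwich_zero hγ hσ hs
    rw [← he1] at h
    exact (h.scomp (1 : ℝ) he).sub_const γ
  have hXe : sandwich γ σ (e 1) - γ = 0 := by rw [he1, hX0, sub_self]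
  have hlin : HasDerivAt
      (fun r => ((sandwich γ σ (e r) - γ) * mfun (fun x => SignType.sign x) γ).trace.re)
      (-(mfun (fun x => |x|) γ * mlog σ).trace.re) 1 := by
    have := hasDerivAt_trace_re (hX.mul_const (mfun (fun x => SignType.sign x) γ))
    refine this.congr_deriv ?_
    rw [smul_mul_assoc, Matrix.trace_smul, Complex.smul_re, trace_mul_add_mul_mul_mfun_sign hγ,
      smul_eq_mul]
    ring
  have hquad : HasDerivAt
      (fun r => ((sandwich γ σ (e r) - γ) * (sandwich γ σ (e r) - γ)).trace.re) 0 1 := by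
    have := hasDerivAt_trace_re (hX.fun_mul hX)
    exact this.congr_deriv (by simp [hXe])
  have hsq : HasDerivAt (fun r : ℝ => (Fintype.card n : ℝ) * (r - 1) ^ 2) 0 1 := by
    have := (((hasDerivAt_id' (1 : ℝ)).sub_const 1).fun_pow 2).const_mul (Fintype.card n : ℝ)
    exact this.congr_deriv (by simp)
  have hQ1 : sandQ 1 γ σ = traceNorm γ := by rw [hQ, he1, hX0, traceNorm]
  set S := fun x : ℝ => (SignType.sign x : ℝ)
  set c := (mfun (fun x => |x| * Real.log x) γ).trace.re
  have hmain : HasDerivAt (fun r => traceNorm γ +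
      ((sandwich γ σ (e r) - γ) * mfun S γ).trace.re + (r - 1) * c)
      (c - (mfun (fun x => |x|) γ * mlog σ).trace.re) 1 := by
    have := (hlin.const_add (traceNorm γ)).fun_add
      (((hasDerivAt_id' (1 : ℝ)).sub_const 1).mul_const c)
    exact this.congr_deriv (by ring)
  obtain ⟨L, hL0, hL⟩ := exists_eventually_abs_log_eigenvalues_sandwich_le hγ hσ hs
  have hev : ∀ᶠ r in 𝓝 (1 : ℝ),
      ∀ i, |Real.log ((isHermitian_sandwich hγ σ (e r)).eigenvalues i)| ≤ L :=
    (he1 ▸ he.continuousAt.tendsto : Tendsto e (𝓝 1) (𝓝 0)).eventually hL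
  have hevγ : ∀ i, |Real.log (hγ.eigenvalues i)| ≤ L := by
    have := hL.self_of_nhds
    simpa only [hX0] using this
  have hsmall : ∀ᶠ r in 𝓝 (1 : ℝ), |r - 1| * L ≤ 1 := by
    have : Tendsto (fun r : ℝ => |r - 1| * L) (𝓝 1) (𝓝 (|1 - 1| * L)) :=
      Continuous.tendsto (by fun_prop) 1
    rw [sub_self, abs_zero, zero_mul] at this
    exact this.eventually_le_const one_pos
  have hrem : HasDerivAt (fun r => sandQ r γ σ - (traceNorm γ +
      ((sandwich γ σ (e r) - γ) * mfun S γ).trace.re + (r - 1) * c)) 0 1 := by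
    rw [hasDerivAt_iff_isLittleO]
    refine Asymptotics.IsBigO.trans_isLittleO ?_ ((hquad.fun_add hsq).isLittleO)
    refine Asymptotics.IsBigO.of_bound
      (Real.exp L * L ^ 2 + 2 * Real.exp L + (L + Real.exp L ^ 2)) ?_
    filter_upwards [hev, hsmall] with r h1 h2
    have h := schattenPow_sub_expansion_le hγ (isHermitian_sandwich hγ σ (e r)) hevγ h1 h2
    have hle := le_abs_self (((sandwich γ σ (e r) - γ) * (sandwich γ σ (e r) - γ)).trace.re +
      (Fintype.card n : ℝ) * (r - 1) ^ 2)
    refine le_trans (le_of_eq ?_)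
      (h.trans (mul_le_mul_of_nonneg_left (hle.trans_eq ?_) (by positivity)))
    · rw [Real.norm_eq_abs]
      congr 1
      simp only [hXe, hQ1, ← hQ]
      simp
      ring
    · simp [hXe]
  simpa using hrem.fun_add hmain

end Derivative

theorem umegakiR_inv_traceNorm_smul_matAbs {γ : Matrix n n ℂ} (hγ : γ.IsHermitian) (hγ0 : γ ≠ 0)
    (σ : Matrix n n ℂ) :
    umegakiR ((traceNorm γ)⁻¹ • matAbs γ) σ = ((mfun (fun x => |x| * Real.log x) γ).trace.re -
      (mfun (fun x => |x|) γ * mlog σ).trace.re) / traceNorm γ - Real.log (traceNorm γ) := by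
  have ht := traceNorm_pos hγ hγ0
  have hlog : (traceNorm γ)⁻¹ • matAbs γ * mlog ((traceNorm γ)⁻¹ • matAbs γ) =
      (traceNorm γ)⁻¹ • (mfun (fun x => |x| * Real.log x) γ -
        Real.log (traceNorm γ) • mfun (fun x => |x|) γ) := by
    rw [matAbs_eq hγ, mfun_const_mul _ _ hγ, mlog, mfun_comp _ _ hγ, mfun_mul _ _ hγ,
      mfun_const_mul _ _ hγ, mfun_sub _ _ hγ, mfun_const_mul _ _ hγ]
    congr 1
    ext x
    rcases eq_or_ne x 0 with rfl | h
    · simp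
    · have hx : (traceNorm γ)⁻¹ * |x| ≠ 0 := by positivity
      rw [if_neg hx, Real.log_mul (by positivity) (by positivity), Real.log_inv, Real.log_abs]
      ring
  rw [umegakiR, mul_sub, hlog, matAbs_eq hγ, smul_mul_assoc, ← smul_sub, Matrix.trace_smul,
    Complex.smul_re, Matrix.trace_sub, Matrix.trace_sub, Matrix.trace_smul, Complex.sub_re,
    Complex.sub_re, Complex.smul_re, ← traceNorm_eq hγ, smul_eq_mul, smul_eq_mul]
  field_simp
  ring

end Auxiliary

/-- limit of the extended sandwiched Rényi divergence as
`α → 1⁺`, corrected by `(α/(α−1)) ln ‖γ‖₁`, is the Umegaki relative entropy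
`D(|γ|/‖γ‖₁ ∥ σ)`. -/
theorem extended_sandwiched_renyi_limit_one
    {n : Type} [Fintype n] [DecidableEq n]
    (γ σ : Matrix n n ℂ) (hγ : γ.IsHermitian) (hγ0 : γ ≠ 0) (hσ : σ.PosSemidef)
    (hs : suppLE γ σ) :
    Filter.Tendsto (fun α : ℝ => sandDR α γ σ - (α / (α - 1)) * Real.log (traceNorm γ))
      (𝓝[>] (1 : ℝ)) (𝓝 (umegakiR ((traceNorm γ)⁻¹ • matAbs γ) σ)) := by
  have ht := traceNorm_pos hγ hγ0
  have hQ1 : sandQ 1 γ σ = traceNorm γ := by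
    have h := sandwich_zero hγ hσ.isHermitian hs
    rw [sandwich] at h
    simp only [sandQ, sub_self, zero_div, h, traceNorm]
  have hd := (hasDerivAt_sandQ_one hγ hσ hs).log (by rw [hQ1]; exact ht.ne')
  have hlim := ((hasDerivAt_iff_tendsto_slope.1 hd).mono_left
    (nhdsWithin_mono 1 fun r (hr : 1 < r) => hr.ne')).sub_const (Real.log (traceNorm γ))
  rw [hQ1, ← umegakiR_inv_traceNorm_smul_matAbs hγ hγ0] at hlim
  refine hlim.congr' ?_
  filter_upwards [self_mem_nhdsWithin] with r hr
  have hr' : r - 1 ≠ 0 := sub_ne_zero.2 (ne_of_gt hr)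
  rw [slope_def_field, hQ1, sandDR]
  field_simp
  ring

end QHE
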